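/- For every n > 2 and every initial configuration c : ZMod n → ℕ with ∑ i, c i ≥ 3*n - 2, every student's pile eventually stabilizes: for each student i there exists a natural number T such that (step^[t] c) i = (step^[T] c) i for all t ≥ T. -/

import Mathlib

def step {n : ℕ} (c : ZMod n → ℕ) : ZMod n → ℕ :=
  fun i =>
    (if 2 ≤ c i then c i - 2 else c i) +
    (if 2 ≤ c (i - 1) then 1 else 0) +
    (if 2 ≤ c (i + 1) then 1 else 0)

theorem sum_step {n : ℕ} [NeZero n] (c : ZMod n → ℕ) : ∑ i, step c i = ∑ i, c i := by
  have hl : ∑ i, (if 2 ≤ c (i - 1) then 1 else 0) = ∑ i, (if 2 ≤ c i then 1 else 0) :=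
    Equiv.sum_comp (Equiv.subRight (1 : ZMod n)) fun i => if 2 ≤ c i then 1 else 0
  have hr : ∑ i, (if 2 ≤ c (i + 1) then 1 else 0) = ∑ i, (if 2 ≤ c i then 1 else 0) :=
    Equiv.sum_comp (Equiv.addRight (1 : ZMod n)) fun i => if 2 ≤ c i then 1 else 0
  simp only [step]
  rw [Finset.sum_add_distrib, Finset.sum_add_distrib, hl, hr, ← Finset.sum_add_distrib,
    ← Finset.sum_add_distrib]
  refine Finset.sum_congr rfl fun i _ => ?_
  split_ifs <;> omega

theorem sum_iterate_step {n : ℕ} [NeZero n] (c : ZMod n → ℕ) (t : ℕ) :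
    ∑ i, (step^[t] c) i = ∑ i, c i := by
  induction t with
  | zero => rfl
  | succ t ih => rw [Function.iterate_succ_apply', sum_step, ih]

theorem step_le_of_two_le {n : ℕ} {c : ZMod n → ℕ} {i : ZMod n} (h : 2 ≤ c i) :
    step c i ≤ c i := by
  simp only [step]
  split_ifs <;> omega

theorem step_le_three {n : ℕ} {c : ZMod n → ℕ} {i : ZMod n} (h : c i ≤ 3) :
    step c i ≤ 3 := by
  simp only [step]
  split_ifs <;> omega

theorem two_le_add_one_of_step_eq {n : ℕ} {c : ZMod n → ℕ} {i : ZMod n} (h : 2 ≤ c i)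
    (he : step c i = c i) : 2 ≤ c (i + 1) := by
  simp only [step] at he
  split_ifs at he <;> omega

theorem iterate_step_le_three {n : ℕ} {c : ZMod n → ℕ} {i : ZMod n} {T t : ℕ} (hTt : T ≤ t)
    (h : (step^[T] c) i ≤ 3) : (step^[t] c) i ≤ 3 := by
  induction t, hTt using Nat.le_induction with
  | base => exact h
  | succ t _ ih =>
    rw [Function.iterate_succ_apply']
    exact step_le_three ih

/-- When the piles have at most three candies each, the total leaves room for at most two
missing candies, so every student has at least two after one round. -/
theorem two_le_step_of_le_three {n : ℕ} [NeZero n] (hn : 2 < n) {c : ZMod n → ℕ}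
    (hc : 3 * n - 2 ≤ ∑ i, c i) (h : ∀ i, c i ≤ 3) (i : ZMod n) : 2 ≤ step c i := by
  have hdeficit : ∑ j, (3 - c j) ≤ 2 := by
    have hsum : ∑ j, (3 - c j) + ∑ j, c j = 3 * n := by
      rw [← Finset.sum_add_distrib, Finset.sum_congr rfl fun j _ => Nat.sub_add_cancel (h j)]
      simp [ZMod.card, mul_comm]
    omega
  have : Fact (1 < n) := ⟨by omega⟩
  have : Fact (2 < n) := ⟨hn⟩
  have hleft : i - 1 ≠ i := by simp
  have hright : i ≠ i + 1 := by simp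
  have hboth : i - 1 ≠ i + 1 := by
    intro he
    apply ZMod.neg_one_ne_one (n := n)
    linear_combination he
  have hlocal : ∑ j ∈ ({i - 1, i, i + 1} : Finset (ZMod n)), (3 - c j) ≤ ∑ j, (3 - c j) :=
    Finset.sum_le_sum_of_subset (Finset.subset_univ _)
  rw [Finset.sum_insert (by simp [hleft, hboth]), Finset.sum_pair hright] at hlocal
  have := h i
  simp only [step]
  split_ifs <;> omega

theorem eventually_const_of_eventually_two_le {n : ℕ} {c : ZMod n → ℕ} {i : ZMod n}
    (h : ∃ T, ∀ t ≥ T, 2 ≤ (step^[t] c) i) :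
    ∃ T, ∀ t ≥ T, 2 ≤ (step^[t] c) i ∧ (step^[t] c) i = (step^[T] c) i := by
  obtain ⟨T, hT⟩ := h
  have hanti : Antitone fun s => (step^[T + s] c) i := by
    refine antitone_nat_of_succ_le fun s => ?_
    rw [← add_assoc, Function.iterate_succ_apply']
    exact step_le_of_two_le (hT _ (Nat.le_add_right _ _))
  obtain ⟨N, hN⟩ : ∃ N, ∀ s, (step^[T + N] c) i ≤ (step^[T + s] c) i :=
    ⟨_, fun s => Function.argmin_le (fun s => (step^[T + s] c) i) s⟩
  refine ⟨T + N, fun t ht => ⟨hT t (by omega), ?_⟩⟩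
  obtain ⟨s, rfl⟩ := Nat.exists_eq_add_of_le (show T ≤ t by omega)
  exact le_antisymm (hanti (by omega)) (hN s)

theorem eventually_two_le_add_one {n : ℕ} {c : ZMod n → ℕ} {i : ZMod n}
    (h : ∃ T, ∀ t ≥ T, 2 ≤ (step^[t] c) i) : ∃ T, ∀ t ≥ T, 2 ≤ (step^[t] c) (i + 1) := by
  obtain ⟨T, hT⟩ := eventually_const_of_eventually_two_le h
  refine ⟨T, fun t ht => two_le_add_one_of_step_eq (hT t ht).1 ?_⟩
  rw [← Function.iterate_succ_apply' step, (hT (t + 1) (by omega)).2, (hT t ht).2]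

theorem eventually_two_le_of_exists {n : ℕ} [NeZero n] {c : ZMod n → ℕ} {i : ZMod n}
    (h : ∃ T, ∀ t ≥ T, 2 ≤ (step^[t] c) i) (j : ZMod n) :
    ∃ T, ∀ t ≥ T, 2 ≤ (step^[t] c) j := by
  have hadd (k : ℕ) : ∃ T, ∀ t ≥ T, 2 ≤ (step^[t] c) (i + k) := by
    induction k with
    | zero => simpa using h
    | succ k ih => simpa [add_assoc] using eventually_two_le_add_one ih
  simpa using hadd (j - i).val

theorem eventually_two_le {n : ℕ} [NeZero n] (hn : 2 < n) {c : ZMod n → ℕ}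
    (hc : 3 * n - 2 ≤ ∑ i, c i) (i : ZMod n) : ∃ T, ∀ t ≥ T, 2 ≤ (step^[t] c) i := by
  by_cases hbig : ∃ j, ∀ t, 3 < (step^[t] c) j
  · obtain ⟨j, hj⟩ := hbig
    exact eventually_two_le_of_exists ⟨0, fun t _ => (Nat.le_succ 2).trans (hj t).le⟩ i
  · push Not at hbig
    choose T hT using hbig
    refine ⟨Finset.univ.sup T + 1, fun t ht => ?_⟩
    obtain ⟨s, rfl⟩ : ∃ s, t = s + 1 := ⟨t - 1, by omega⟩
    rw [Function.iterate_succ_apply']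
    refine two_le_step_of_le_three hn (by rwa [sum_iterate_step]) (fun j => ?_) i
    have : T j ≤ Finset.univ.sup T := Finset.le_sup (Finset.mem_univ j)
    exact iterate_step_le_three (by omega) (hT j)

theorem every_pile_stabilizes (n : ℕ) [NeZero n] (hn : 2 < n) (c : ZMod n → ℕ)
    (hc : 3 * n - 2 ≤ ∑ i, c i) :
    ∀ i : ZMod n, ∃ T : ℕ, ∀ t ≥ T, (step^[t] c) i = (step^[T] c) i := by
  intro i
  obtain ⟨T, hT⟩ := eventually_const_of_eventually_two_le (eventually_two_le hn hc i)
  exact ⟨T, fun t ht => (hT t ht).2⟩
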